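/- arXiv:0805.0762 — 3 statements merged into one kernel-verified Lean document; each statement's English description precedes it below -/
import Mathlib

section
/- Let Ā be a unital dendriform algebra and c ∈ A. Let Y ∈ Ā[[λ]] be the solution of Y = 1 + λ c ≺ Y and let Ỹ ∈ Ā[[λ]] be the solution of Ỹ = 1 − λ Ỹ ≻ c. Then Ỹ * Y = 1 = Y * Ỹ, i.e. Ỹ is the inverse of Y for the associative product *. Similarly, if Z solves Z = 1 + λ Z ≻ b and Z̃ solves Z̃ = 1 − λ b ≺ Z̃ for b ∈ A, then Z̃ * Z = 1 = Z * Z̃. -/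
open Finset

section DendriformAug

variable {k : Type} [Field k] [CharZero k]
variable {D : Type} [AddCommGroup D] [Module k D]

/-- Elements of `Ā[[λ]]`, the power series over the augmentation `Ā = k·1 ⊕ D` of a
dendriform algebra `D` by a unit `1`, represented as a pair consisting of the
scalar-part series and the `D`-part series. -/
abbrev Aug (k D : Type) : Type := (ℕ → k) × (ℕ → D)

/-- The unit `1` of `Ā[[λ]]`. -/
def augOne : Aug k D := (fun n => if n = 0 then 1 else 0, 0)

/-- The embedding of `D` into `Ā[[λ]]` as constant series. -/
def ofD (a : D) : Aug k D := (0, fun n => if n = 0 then a else 0)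

/-- Multiplication by the formal parameter `λ` on `Ā[[λ]]`. -/
def lam (x : Aug k D) : Aug k D :=
  (fun n => match n with | 0 => 0 | Nat.succ m => x.1 m,
   fun n => match n with | 0 => 0 | Nat.succ m => x.2 m)

variable (p s : D →ₗ[k] D →ₗ[k] D)

/-- Cauchy convolution of two `D`-valued series along a bilinear operation on `D`. -/
def conv (b : D →ₗ[k] D →ₗ[k] D) (f g : ℕ → D) : ℕ → D :=
  fun n => ∑ ij ∈ antidiagonal n, b (f ij.1) (g ij.2)

/-- Cauchy convolution of a scalar series with a `D`-valued series. -/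
def sconv (t : ℕ → k) (f : ℕ → D) : ℕ → D :=
  fun n => ∑ ij ∈ antidiagonal n, t ij.1 • f ij.2

/-- Cauchy convolution of two scalar series. -/
def kconv (u t : ℕ → k) : ℕ → k :=
  fun n => ∑ ij ∈ antidiagonal n, u ij.1 * t ij.2

/-- The left dendriform product `≺` on `Ā[[λ]]`, extending `p : D → D → D`
λ-adically, with `1 ≺ a = 0` and `a ≺ 1 = a` for `a ∈ D[[λ]]`
(`1 ≺ 1` being left undefined, no scalar part is produced). -/
def precA (x y : Aug k D) : Aug k D :=
  (0, conv p x.2 y.2 + sconv y.1 x.2)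

/-- The right dendriform product `≻` on `Ā[[λ]]`, extending `s : D → D → D`
λ-adically, with `1 ≻ a = a` and `a ≻ 1 = 0` for `a ∈ D[[λ]]`
(`1 ≻ 1` being left undefined, no scalar part is produced). -/
def succA (x y : Aug k D) : Aug k D :=
  (0, conv s x.2 y.2 + sconv x.1 y.2)

/-- The associative product `x * y = x ≺ y + x ≻ y` on `Ā[[λ]]`, for which the
unit satisfies `a * 1 = 1 * a = a` and `1 * 1 = 1`. -/
def starA (x y : Aug k D) : Aug k D :=
  (kconv x.1 y.1,
   conv p x.2 y.2 + conv s x.2 y.2 + sconv y.1 x.2 + sconv x.1 y.2)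

omit [CharZero k] in
theorem conv_succ_of_left (m : D →ₗ[k] D →ₗ[k] D) {f g : ℕ → D} (h : f 0 = 0) (n : ℕ) :
    conv m f g (n + 1) = ∑ ij ∈ antidiagonal n, m (f (ij.1 + 1)) (g ij.2) := by
  simp [conv, Nat.sum_antidiagonal_succ, h]

omit [CharZero k] in
theorem conv_succ_of_right (m : D →ₗ[k] D →ₗ[k] D) {f g : ℕ → D} (h : g 0 = 0) (n : ℕ) :
    conv m f g (n + 1) = ∑ ij ∈ antidiagonal n, m (f ij.1) (g (ij.2 + 1)) := by
  simp [conv, Nat.sum_antidiagonal_succ', h]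

theorem sum_antidiagonal_left_ite {M : Type} [AddCommMonoid M] (f : ℕ → M) (n : ℕ) :
    ∑ ij ∈ antidiagonal n, (if ij.1 = 0 then f ij.2 else 0) = f n := by
  cases n <;> simp [Nat.sum_antidiagonal_succ]

theorem sum_antidiagonal_right_ite {M : Type} [AddCommMonoid M] (f : ℕ → M) (n : ℕ) :
    ∑ ij ∈ antidiagonal n, (if ij.2 = 0 then f ij.1 else 0) = f n := by
  cases n <;> simp [Nat.sum_antidiagonal_succ']

/-- `y` is the `D`-part of a solution of `Y = 1 + λ c ≺ Y`. -/
def IsPrecSolution (c : D) (y : ℕ → D) : Prop :=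
  y 0 = 0 ∧ ∀ n, y (n + 1) = p c (y n) + if n = 0 then c else 0

/-- `z` is the `D`-part of a solution of `Z = 1 - λ Z ≻ c`. -/
def IsSuccSolution (c : D) (z : ℕ → D) : Prop :=
  z 0 = 0 ∧ ∀ n, z (n + 1) = -(s (z n) c + if n = 0 then c else 0)

variable {p s}

omit [CharZero k] in
theorem IsSuccSolution.conv_add_conv {c : D} {y z : ℕ → D}
    (ax2 : ∀ a b c : D, p (s a b) c = s a (p b c))
    (hz : IsSuccSolution s c z) (hy : IsPrecSolution p c y) :
    conv p z y + conv s z y + z + y = 0 := by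
  funext n
  cases n with
  | zero => simp [conv, hy.1, hz.1]
  | succ n =>
    have h1 : conv p z y (n + 1) = -(conv s z (fun j => p c (y j)) n + p c (y n)) := by
      rw [conv_succ_of_left p hz.1, ← sum_antidiagonal_left_ite (fun j => p c (y j)) n, conv,
        ← sum_add_distrib, ← sum_neg_distrib]
      refine sum_congr rfl fun ij _ => ?_
      rw [hz.2]
      split_ifs <;> simp [ax2]
    have h2 : conv s z y (n + 1) = conv s z (fun j => p c (y j)) n + s (z n) c := by
      rw [conv_succ_of_right s hy.1, ← sum_antidiagonal_right_ite (fun i => s (z i) c) n, conv,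
        ← sum_add_distrib]
      refine sum_congr rfl fun ij _ => ?_
      rw [hy.2]
      split_ifs <;> simp
    simp only [Pi.add_apply, Pi.zero_apply, h1, h2, hy.2, hz.2]
    abel

omit [CharZero k] in
theorem IsPrecSolution.conv_add_conv {c : D} {y z : ℕ → D}
    (ax1 : ∀ a b c : D, p (p a b) c = p a (p b c + s b c))
    (ax3 : ∀ a b c : D, s a (s b c) = s (p a b + s a b) c)
    (hy : IsPrecSolution p c y) (hz : IsSuccSolution s c z) :
    conv p y z + conv s y z + y + z = 0 := by
  funext n
  induction n with
  | zero => simp [conv, hy.1, hz.1]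
  | succ n ih =>
    have h1 : conv p y z (n + 1) = p c (conv p y z n + conv s y z n) + p c (z n) := by
      rw [conv_succ_of_left p hy.1, ← sum_antidiagonal_left_ite (fun j => p c (z j)) n, conv, conv,
        ← sum_add_distrib, map_sum, ← sum_add_distrib]
      refine sum_congr rfl fun ij _ => ?_
      rw [hy.2]
      split_ifs <;> simp [ax1]
    have h2 : conv s y z (n + 1) = -(s (conv p y z n + conv s y z n) c + s (y n) c) := by
      rw [conv_succ_of_right s hz.1, ← sum_antidiagonal_right_ite (fun i => s (y i) c) n, conv,
        conv, ← sum_add_distrib, map_sum, LinearMap.sum_apply, ← sum_add_distrib,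
        ← sum_neg_distrib]
      refine sum_congr rfl fun ij _ => ?_
      rw [hz.2]
      split_ifs <;> simp [ax3]
    have hw : conv p y z n + conv s y z n = -(y n + z n) := by
      rw [eq_neg_iff_add_eq_zero, ← add_assoc]
      exact ih
    simp only [Pi.add_apply, Pi.zero_apply, h1, h2, hw, hy.2, hz.2, map_add, map_neg,
      LinearMap.add_apply, LinearMap.neg_apply]
    abel

omit [CharZero k] in
theorem sconv_augOne (f : ℕ → D) : sconv (augOne : Aug k D).1 f = f := by
  funext n
  rw [← sum_antidiagonal_left_ite f n]
  refine sum_congr rfl fun ij _ => ?_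
  simp [augOne]

omit [CharZero k] in
theorem starA_eq_augOne {x y : Aug k D} (hx : x.1 = (augOne : Aug k D).1)
    (hy : y.1 = (augOne : Aug k D).1)
    (h : conv p x.2 y.2 + conv s x.2 y.2 + x.2 + y.2 = 0) : starA p s x y = augOne := by
  refine Prod.ext ?_ ?_
  · funext n
    change kconv x.1 y.1 n = _
    rw [hx, hy, ← sum_antidiagonal_left_ite (augOne : Aug k D).1 n]
    refine sum_congr rfl fun ij _ => ?_
    by_cases h' : ij.1 = 0 <;> simp [augOne, h']
  · change conv p x.2 y.2 + conv s x.2 y.2 + sconv y.1 x.2 + sconv x.1 y.2 = 0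
    rw [hx, hy, sconv_augOne, sconv_augOne, h]

omit [CharZero k] [Module k D] in
theorem lam_fst_eq_zero {x : Aug k D} (h : x.1 = 0) : (lam x).1 = 0 := by
  funext n
  cases n <;> simp [lam, h]

omit [CharZero k] in
theorem precA_ofD_snd (c : D) {y : Aug k D} (hy : y.1 = (augOne : Aug k D).1) (n : ℕ) :
    (precA p (ofD c) y).2 n = p c (y.2 n) + if n = 0 then c else 0 := by
  change conv p (ofD c : Aug k D).2 y.2 n + sconv y.1 (ofD c : Aug k D).2 n = _
  rw [hy, sconv_augOne, ← sum_antidiagonal_left_ite (fun j => p c (y.2 j)) n]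
  congr 1
  refine sum_congr rfl fun ij _ => ?_
  simp only [ofD]
  split_ifs <;> simp

omit [CharZero k] in
theorem succA_ofD_snd (c : D) {y : Aug k D} (hy : y.1 = (augOne : Aug k D).1) (n : ℕ) :
    (succA s y (ofD c)).2 n = s (y.2 n) c + if n = 0 then c else 0 := by
  change conv s y.2 (ofD c : Aug k D).2 n + sconv y.1 (ofD c : Aug k D).2 n = _
  rw [hy, sconv_augOne, ← sum_antidiagonal_right_ite (fun i => s (y.2 i) c) n]
  congr 1
  refine sum_congr rfl fun ij _ => ?_
  simp only [ofD]
  split_ifs <;> simp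

omit [CharZero k] [Module k D] in
theorem fst_eq_of_eq_augOne_add {x y : Aug k D} (hy : y.1 = 0) (h : x = augOne + lam y) :
    x.1 = (augOne : Aug k D).1 := by
  rw [h, Prod.fst_add, lam_fst_eq_zero hy, add_zero]

omit [CharZero k] [Module k D] in
theorem fst_eq_of_eq_augOne_sub {x y : Aug k D} (hy : y.1 = 0) (h : x = augOne - lam y) :
    x.1 = (augOne : Aug k D).1 := by
  rw [h, Prod.fst_sub, lam_fst_eq_zero hy, sub_zero]

omit [CharZero k] [Module k D] in
theorem snd_of_eq_augOne_add {x y : Aug k D} (h : x = augOne + lam y) :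
    x.2 0 = 0 ∧ ∀ n, x.2 (n + 1) = y.2 n := by
  subst h
  simp [augOne, lam]

omit [CharZero k] [Module k D] in
theorem snd_of_eq_augOne_sub {x y : Aug k D} (h : x = augOne - lam y) :
    x.2 0 = 0 ∧ ∀ n, x.2 (n + 1) = -y.2 n := by
  subst h
  simp [augOne, lam]

variable (p s)

/-- Let `Ā` be a unital dendriform algebra and `b c ∈ A`.  If `Y` solves
`Y = 1 + λ c ≺ Y` and `Ỹ` solves `Ỹ = 1 − λ Ỹ ≻ c`, then `Ỹ * Y = 1 = Y * Ỹ`;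
similarly if `Z` solves `Z = 1 + λ Z ≻ b` and `Z̃` solves `Z̃ = 1 − λ b ≺ Z̃`, then
`Z̃ * Z = 1 = Z * Z̃`. -/
theorem dendriform_solutions_inverse
    (ax1 : ∀ a b c : D, p (p a b) c = p a (p b c + s b c))
    (ax2 : ∀ a b c : D, p (s a b) c = s a (p b c))
    (ax3 : ∀ a b c : D, s a (s b c) = s (p a b + s a b) c)
    (b c : D) (Y Yt Z Zt : Aug k D)
    (hY : Y = augOne + lam (precA p (ofD c) Y))
    (hYt : Yt = augOne - lam (succA s Yt (ofD c)))
    (hZ : Z = augOne + lam (succA s Z (ofD b)))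
    (hZt : Zt = augOne - lam (precA p (ofD b) Zt)) :
    starA p s Yt Y = augOne ∧ starA p s Y Yt = augOne ∧
    starA p s Zt Z = augOne ∧ starA p s Z Zt = augOne := by
  have hY1 := fst_eq_of_eq_augOne_add rfl hY
  have hYt1 := fst_eq_of_eq_augOne_sub rfl hYt
  have hZ1 := fst_eq_of_eq_augOne_add rfl hZ
  have hZt1 := fst_eq_of_eq_augOne_sub rfl hZt
  have hYs : IsPrecSolution p c Y.2 := by
    refine ⟨(snd_of_eq_augOne_add hY).1, fun n => ?_⟩
    rw [(snd_of_eq_augOne_add hY).2, precA_ofD_snd c hY1]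
  have hYts : IsSuccSolution s c Yt.2 := by
    refine ⟨(snd_of_eq_augOne_sub hYt).1, fun n => ?_⟩
    rw [(snd_of_eq_augOne_sub hYt).2, succA_ofD_snd c hYt1]
  have hZs : IsSuccSolution s (-b) Z.2 := by
    refine ⟨(snd_of_eq_augOne_add hZ).1, fun n => ?_⟩
    rw [(snd_of_eq_augOne_add hZ).2, succA_ofD_snd b hZ1]
    split_ifs <;> simp [add_comm]
  have hZts : IsPrecSolution p (-b) Zt.2 := by
    refine ⟨(snd_of_eq_augOne_sub hZt).1, fun n => ?_⟩
    rw [(snd_of_eq_augOne_sub hZt).2, precA_ofD_snd b hZt1]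
    split_ifs <;> simp [add_comm]
  exact ⟨starA_eq_augOne hYt1 hY1 (hYts.conv_add_conv ax2 hYs),
    starA_eq_augOne hY1 hYt1 (hYs.conv_add_conv ax1 ax3 hYts),
    starA_eq_augOne hZt1 hZ1 (hZts.conv_add_conv ax1 ax3 hZs),
    starA_eq_augOne hZ1 hZt1 (hZs.conv_add_conv ax2 hZts)⟩

end DendriformAug
end

section
/- Let Ā be a unital dendriform algebra and a, b, c ∈ A. Let Y ∈ Ā[[λ]] be the solution of Y = 1 + λ c ≺ Y with inverse Y⁻¹ (solving Y⁻¹ = 1 − λ Y⁻¹ ≻ c), and let Z ∈ Ā[[λ]] be the solution of Z = 1 + λ Z ≻ b with inverse Z⁻¹ (solving Z⁻¹ = 1 − λ b ≺ Z⁻¹). Then X := Y * (Y⁻¹ ≻ a ≺ Z⁻¹) * Z solves the degree (1,1) equation X = a + λ X ≻ b + λ c ≺ X in Ā[[λ]]. -/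
open Finset

section DendriformAug

variable {k : Type} [Field k] [CharZero k]
variable {D : Type} [AddCommGroup D] [Module k D]

variable (p s : D →ₗ[k] D →ₗ[k] D)

/-- Cauchy convolution of two series along a bilinear map between modules. -/
def bilinConv {M N P : Type} [AddCommGroup M] [Module k M] [AddCommGroup N] [Module k N]
    [AddCommGroup P] [Module k P] (B : M →ₗ[k] N →ₗ[k] P) (f : ℕ → M) (g : ℕ → N) : ℕ → P :=
  fun n => ∑ ij ∈ antidiagonal n, B (f ij.1) (g ij.2)

omit [CharZero k] in
theorem bilinConv_assoc {M N P Q R S : Type} [AddCommGroup M] [Module k M]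
    [AddCommGroup N] [Module k N] [AddCommGroup P] [Module k P] [AddCommGroup Q] [Module k Q]
    [AddCommGroup R] [Module k R] [AddCommGroup S] [Module k S]
    (B₁ : M →ₗ[k] N →ₗ[k] Q) (B₂ : Q →ₗ[k] P →ₗ[k] S)
    (B₃ : N →ₗ[k] P →ₗ[k] R) (B₄ : M →ₗ[k] R →ₗ[k] S)
    (h : ∀ x y z, B₂ (B₁ x y) z = B₄ x (B₃ y z)) (f : ℕ → M) (g : ℕ → N) (e : ℕ → P) :
    bilinConv B₂ (bilinConv B₁ f g) e = bilinConv B₄ f (bilinConv B₃ g e) := by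
  funext n
  simp only [bilinConv, map_sum, LinearMap.sum_apply, h, Finset.sum_sigma']
  refine Finset.sum_nbij' (fun ⟨⟨_, j⟩, ⟨u, v⟩⟩ => ⟨(u, v + j), (v, j)⟩)
    (fun ⟨⟨i, _⟩, ⟨u, v⟩⟩ => ⟨(i + u, v), (i, u)⟩) ?_ ?_ ?_ ?_ ?_ <;>
  rintro ⟨⟨i, j⟩, ⟨u, v⟩⟩ h <;>
  simp only [Finset.mem_sigma, HasAntidiagonal.mem_antidiagonal] at h ⊢ <;>
  obtain ⟨rfl, rfl⟩ := h <;>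
  simp [add_assoc]

/-- An element of `Ā[[λ]]` as a power series with coefficients in `k × D`. -/
def augSeries (x : Aug k D) : ℕ → k × D := fun n => (x.1 n, x.2 n)

omit [Field k] [CharZero k] [AddCommGroup D] [Module k D] in
theorem augSeries_injective : Function.Injective (augSeries : Aug k D → ℕ → k × D) := by
  intro x y h
  ext n
  · exact congrArg Prod.fst (congrFun h n)
  · exact congrArg Prod.snd (congrFun h n)

/-- The left dendriform product on the augmentation `k × D`. -/
def precUnit : (k × D) →ₗ[k] (k × D) →ₗ[k] (k × D) :=
  LinearMap.mk₂ k (fun x y => (0, p x.2 y.2 + y.1 • x.2))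
    (by intros; ext <;> simp; module) (by intros; ext <;> simp; module)
    (by intros; ext <;> simp; module) (by intros; ext <;> simp; module)

/-- The right dendriform product on the augmentation `k × D`. -/
def succUnit : (k × D) →ₗ[k] (k × D) →ₗ[k] (k × D) :=
  LinearMap.mk₂ k (fun x y => (0, s x.2 y.2 + x.1 • y.2))
    (by intros; ext <;> simp; module) (by intros; ext <;> simp; module)
    (by intros; ext <;> simp; module) (by intros; ext <;> simp; module)

/-- The associative product on the augmentation `k × D`. -/
def starUnit : (k × D) →ₗ[k] (k × D) →ₗ[k] (k × D) :=
  LinearMap.mk₂ k (fun x y => (x.1 * y.1, p x.2 y.2 + s x.2 y.2 + y.1 • x.2 + x.1 • y.2))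
    (by intros; ext; exacts [add_mul _ _ _, by simp; module])
    (by intros; ext; exacts [mul_assoc _ _ _, by simp; module])
    (by intros; ext; exacts [mul_add _ _ _, by simp; module])
    (by intros; ext; exacts [mul_left_comm _ _ _, by simp; module])

omit [CharZero k] in
theorem sconv_eq_sum_swap (t : ℕ → k) (f : ℕ → D) (n : ℕ) :
    sconv t f n = ∑ ij ∈ antidiagonal n, t ij.2 • f ij.1 :=
  (Finset.Nat.sum_antidiagonal_swap (f := fun ij => t ij.1 • f ij.2)).symm

omit [CharZero k] in
theorem augSeries_precA (x y : Aug k D) :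
    augSeries (precA p x y) = bilinConv (precUnit p) (augSeries x) (augSeries y) := by
  funext n
  ext <;> simp [augSeries, precA, bilinConv, precUnit, conv, sconv_eq_sum_swap, Prod.fst_sum,
    Prod.snd_sum, Finset.sum_add_distrib]

omit [CharZero k] in
theorem augSeries_succA (x y : Aug k D) :
    augSeries (succA s x y) = bilinConv (succUnit s) (augSeries x) (augSeries y) := by
  funext n
  ext <;> simp [augSeries, succA, bilinConv, succUnit, conv, sconv, Prod.fst_sum,
    Prod.snd_sum, Finset.sum_add_distrib]

omit [CharZero k] in
theorem augSeries_starA (x y : Aug k D) :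
    augSeries (starA p s x y) = bilinConv (starUnit p s) (augSeries x) (augSeries y) := by
  funext n
  ext
  · simp [augSeries, starA, bilinConv, starUnit, kconv, Prod.fst_sum]
  · simp only [augSeries, starA, bilinConv, starUnit, conv, Prod.snd_sum, Pi.add_apply,
      LinearMap.mk₂_apply, Finset.sum_add_distrib, sconv_eq_sum_swap y.1]
    rfl

section Associativity

variable {p s}

omit [CharZero k] in
theorem precA_precA (ax1 : ∀ a b c : D, p (p a b) c = p a (p b c + s b c)) (x y z : Aug k D) :
    precA p (precA p x y) z = precA p x (starA p s y z) := by
  apply augSeries_injective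
  simp only [augSeries_precA, augSeries_starA]
  apply bilinConv_assoc
  intro x y z
  ext
  · simp [precUnit, starUnit]
  · simp [precUnit, starUnit, ax1]
    module

omit [CharZero k] in
theorem precA_succA (ax2 : ∀ a b c : D, p (s a b) c = s a (p b c)) (x y z : Aug k D) :
    precA p (succA s x y) z = succA s x (precA p y z) := by
  apply augSeries_injective
  simp only [augSeries_precA, augSeries_succA]
  apply bilinConv_assoc
  intro x y z
  ext
  · simp [precUnit, succUnit]
  · simp [precUnit, succUnit, ax2]
    module

omit [CharZero k] in
theorem succA_starA (ax3 : ∀ a b c : D, s a (s b c) = s (p a b + s a b) c) (x y z : Aug k D) :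
    succA s (starA p s x y) z = succA s x (succA s y z) := by
  apply augSeries_injective
  simp only [augSeries_succA, augSeries_starA]
  apply bilinConv_assoc
  intro x y z
  ext
  · simp [succUnit, starUnit]
  · simp [succUnit, starUnit, ax3]
    module

omit [CharZero k] in
theorem starA_assoc (ax1 : ∀ a b c : D, p (p a b) c = p a (p b c + s b c))
    (ax2 : ∀ a b c : D, p (s a b) c = s a (p b c))
    (ax3 : ∀ a b c : D, s a (s b c) = s (p a b + s a b) c) (x y z : Aug k D) :
    starA p s (starA p s x y) z = starA p s x (starA p s y z) := by
  apply augSeries_injective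
  simp only [augSeries_starA]
  apply bilinConv_assoc
  intro x y z
  ext
  · simp [starUnit, mul_assoc]
  · simp [starUnit, ax1, ax2, ax3]
    module

end Associativity

omit [CharZero k] in
theorem kconv_zero_left (t : ℕ → k) : kconv 0 t = 0 := by
  funext n
  simp [kconv]

omit [CharZero k] in
theorem kconv_zero_right (t : ℕ → k) : kconv t 0 = 0 := by
  funext n
  simp [kconv]

omit [CharZero k] in
theorem starA_eq_of_left {x : Aug k D} (hx : x.1 = 0) (y : Aug k D) :
    starA p s x y = precA p x y + succA s x y := by
  ext n
  · simp [starA, precA, succA, hx, kconv_zero_left]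
  · simp [starA, precA, succA]
    abel

omit [CharZero k] in
theorem starA_eq_of_right (x : Aug k D) {y : Aug k D} (hy : y.1 = 0) :
    starA p s x y = precA p x y + succA s x y := by
  ext n
  · simp [starA, precA, succA, hy, kconv_zero_right]
  · simp [starA, precA, succA]
    abel

omit [CharZero k] in
theorem precA_add_left (x y z : Aug k D) : precA p (x + y) z = precA p x z + precA p y z := by
  ext n
  · simp [precA]
  · simp [precA, conv, sconv, Finset.sum_add_distrib]
    abel

omit [CharZero k] in
theorem succA_add_right (x y z : Aug k D) : succA s x (y + z) = succA s x y + succA s x z := by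
  ext n
  · simp [succA]
  · simp [succA, conv, sconv, Finset.sum_add_distrib]
    abel

omit [CharZero k] in
theorem precA_lam_left (x y : Aug k D) : precA p (lam x) y = lam (precA p x y) := by
  ext n
  · cases n <;> simp [precA, lam]
  · cases n <;> simp [precA, lam, conv, sconv_eq_sum_swap, Finset.Nat.sum_antidiagonal_succ]

omit [CharZero k] in
theorem succA_lam_right (x y : Aug k D) : succA s x (lam y) = lam (succA s x y) := by
  ext n
  · cases n <;> simp [succA, lam]
  · cases n <;> simp [succA, lam, conv, sconv, Finset.Nat.sum_antidiagonal_succ']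

omit [CharZero k] in
theorem precA_augOne_left (x : Aug k D) : precA p augOne x = 0 := by
  ext n <;> simp [precA, augOne, conv, sconv]

omit [CharZero k] in
theorem succA_augOne_right (x : Aug k D) : succA s x augOne = 0 := by
  ext n <;> simp [succA, augOne, conv, sconv]

omit [CharZero k] in
theorem sconv_unit (f : ℕ → D) : sconv (fun n => if n = 0 then (1 : k) else 0) f = f := by
  funext n
  cases n <;> simp [sconv, Finset.Nat.sum_antidiagonal_succ]

omit [CharZero k] in
theorem succA_augOne_left {x : Aug k D} (hx : x.1 = 0) : succA s augOne x = x := by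
  ext n <;> simp [succA, augOne, sconv_unit, hx, conv]

omit [CharZero k] in
theorem precA_augOne_right {x : Aug k D} (hx : x.1 = 0) : precA p x augOne = x := by
  ext n <;> simp [precA, augOne, sconv_unit, hx, conv]

/-- Let `Ā` be a unital dendriform algebra and `a b c ∈ A`.  Let `Y` solve
`Y = 1 + λ c ≺ Y` with inverse `Y⁻¹` solving `Y⁻¹ = 1 − λ Y⁻¹ ≻ c`, and `Z` solve
`Z = 1 + λ Z ≻ b` with inverse `Z⁻¹` solving `Z⁻¹ = 1 − λ b ≺ Z⁻¹`.  Then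
`X := Y * (Y⁻¹ ≻ a ≺ Z⁻¹) * Z` solves the degree `(1,1)` equation
`X = a + λ X ≻ b + λ c ≺ X`. -/
theorem dendriform_degree_one_one_solution
    (ax1 : ∀ a b c : D, p (p a b) c = p a (p b c + s b c))
    (ax2 : ∀ a b c : D, p (s a b) c = s a (p b c))
    (ax3 : ∀ a b c : D, s a (s b c) = s (p a b + s a b) c)
    (a b c : D) (Y Yi Z Zi X : Aug k D)
    (hY : Y = augOne + lam (precA p (ofD c) Y))
    (hYi : Yi = augOne - lam (succA s Yi (ofD c)))
    (hYinv : starA p s Y Yi = augOne ∧ starA p s Yi Y = augOne)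
    (hZ : Z = augOne + lam (succA s Z (ofD b)))
    (hZi : Zi = augOne - lam (precA p (ofD b) Zi))
    (hZinv : starA p s Z Zi = augOne ∧ starA p s Zi Z = augOne)
    (hX : X = starA p s (starA p s Y (precA p (succA s Yi (ofD a)) Zi)) Z) :
    X = ofD a + lam (succA s X (ofD b)) + lam (precA p (ofD c) X) := by
  have hW : (precA p (succA s Yi (ofD a)) Zi).1 = 0 := rfl
  set W := precA p (succA s Yi (ofD a)) Zi with hWdef
  have hV : (starA p s W Z).1 = 0 := by simp [starA, hW, kconv_zero_left]
  have hXV : X = starA p s Y (starA p s W Z) := by rw [hX, starA_assoc ax1 ax2 ax3]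
  have hprec : precA p Y (starA p s W Z) = lam (precA p (ofD c) X) := by
    nth_rewrite 1 [hY]
    rw [precA_add_left, precA_augOne_left, zero_add, precA_lam_left, precA_precA ax1, ← hXV]
  have hsucc : succA s W Z = lam (succA s (starA p s W Z) (ofD b)) := by
    nth_rewrite 1 [hZ]
    rw [succA_add_right, succA_augOne_right, zero_add, succA_lam_right, succA_starA ax3]
  have hcancel : succA s Y (precA p W Z) = ofD a := by
    rw [hWdef, precA_precA ax1, hZinv.2, precA_augOne_right p rfl, ← succA_starA ax3, hYinv.1,
      succA_augOne_left s rfl]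
  have hYV : succA s Y (starA p s W Z) = ofD a + lam (succA s X (ofD b)) := by
    rw [hXV, succA_starA ax3]
    nth_rewrite 1 [starA_eq_of_left p s hW]
    rw [succA_add_right, hcancel, hsucc, succA_lam_right]
  rw [← hYV, ← hprec, add_comm, ← starA_eq_of_right p s Y hV, ← hXV]

end DendriformAug
end

section
/- Let D be a dendriform algebra and a, b, c ∈ D. Let X̂ ∈ D̄[[λ]] be the solution of the degree (0,2) equation X̂ = 1 + λ c ≺ X̂ + λ² a ≺ (b ≺ X̂). Then the column vector Ŷ := (X̂, λ b ≺ X̂)ᵗ in (D̄[[λ]])² is a solution of the equation Ŷ = 1₂·v + λ Mᵗ ≺ Ŷ, with v = (1, 0)ᵗ ∈ k² and Mᵗ the 2×2 matrix with rows (c, a) and (b, 0), where (Mᵗ ≺ Ŷ)_i := Σ_k (Mᵗ)_{ik} ≺ Ŷ_k. -/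
open Finset

section DendriformAug

variable {k : Type} [Field k] [CharZero k]
variable {D : Type} [AddCommGroup D] [Module k D]

variable (p s : D →ₗ[k] D →ₗ[k] D)

theorem precA_ofD (a : D) (y : Aug k D) :
    precA p (ofD a) y = (0, fun n => p a (y.2 n) + y.1 n • a) := by
  refine Prod.ext rfl (funext fun n => ?_)
  simp only [precA, conv, sconv, ofD, Pi.add_apply]
  congr 1
  · rw [Finset.sum_eq_single (0, n)]
    · simp
    · rintro ⟨i, j⟩ h hne
      have hi : i ≠ 0 := by
        rintro rfl
        simp_all
      simp [hi]
    · simp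
  · rw [Finset.sum_eq_single (n, 0)]
    · simp
    · rintro ⟨i, j⟩ h hne
      have hj : j ≠ 0 := by
        rintro rfl
        simp_all
      simp [hj]
    · simp

theorem precA_zero_left (y : Aug k D) : precA p (ofD 0) y = 0 := by
  rw [precA_ofD]
  ext n <;> simp

theorem precA_ofD_lam (a : D) (y : Aug k D) :
    precA p (ofD a) (lam y) = lam (precA p (ofD a) y) := by
  simp only [precA_ofD]
  ext n <;> cases n <;> simp [lam]

theorem lam_add (x y : Aug k D) : lam (x + y) = lam x + lam y := by
  ext n <;> cases n <;> simp [lam]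

/-- Let `D` be a dendriform algebra, `a b c ∈ D`, and `X̂ ∈ D̄[[λ]]` the solution of
the degree `(0,2)` equation `X̂ = 1 + λ c ≺ X̂ + λ² a ≺ (b ≺ X̂)`.  Then the column
vector `Ŷ := (X̂, λ b ≺ X̂)ᵗ` solves `Ŷ = 1₂·v + λ Mᵗ ≺ Ŷ`, with `v = (1, 0)ᵗ ∈ k²`
and `Mᵗ` the matrix with rows `(c, a)` and `(b, 0)`, where
`(Mᵗ ≺ Ŷ)_i := Σ_l (Mᵗ)_{il} ≺ Ŷ_l`. -/
theorem dendriform_degree_zero_two_to_vector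
    (ax1 : ∀ a b c : D, p (p a b) c = p a (p b c + s b c))
    (ax2 : ∀ a b c : D, p (s a b) c = s a (p b c))
    (ax3 : ∀ a b c : D, s a (s b c) = s (p a b + s a b) c)
    (a b c : D) (Xh : Aug k D)
    (hXh : Xh = augOne + lam (precA p (ofD c) Xh)
      + lam (lam (precA p (ofD a) (precA p (ofD b) Xh))))
    (Mt : Matrix (Fin 2) (Fin 2) D) (hMt : Mt = !![c, a; b, 0])
    (v : Fin 2 → k) (hv : v = ![1, 0])
    (Yh : Fin 2 → Aug k D) (hYh : Yh = ![Xh, lam (precA p (ofD b) Xh)]) :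
    ∀ i : Fin 2,
      Yh i = v i • augOne + lam (∑ l : Fin 2, precA p (ofD (Mt i l)) (Yh l)) := by
  subst hMt hv hYh
  intro i
  fin_cases i
  · simpa [precA_ofD_lam, lam_add, add_assoc] using hXh
  · simp [precA_zero_left]

end DendriformAug
end
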